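/- Let A be a simple finite-dimensional k-algebra of dimension n. Then the rank of the multiplication tensor M_A ∈ A* ⊗ A* ⊗ A (i.e., the minimal r such that M_A is a sum of r rank-one tensors α ⊗ β ⊗ c) is at least 2n − 1. -/

import Mathlib

section MultiplicationRank

variable {k : Type*} [Field k]

section RangeRank

variable {U V W : Type*} [AddCommGroup U] [Module k U] [AddCommGroup V] [Module k V]
  [AddCommGroup W] [Module k W]

/-- The rank of a linear map, as a natural number. -/
noncomputable def mapRank (f : V →ₗ[k] W) : ℕ := Module.finrank k (LinearMap.range f)

theorem mapRank_add_le [FiniteDimensional k W] (f g : V →ₗ[k] W) :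
    mapRank (f + g) ≤ mapRank f + mapRank g := by
  have h : LinearMap.range (f + g) ≤ LinearMap.range f ⊔ LinearMap.range g := by
    rintro _ ⟨v, rfl⟩
    exact Submodule.add_mem_sup ⟨v, rfl⟩ ⟨v, rfl⟩
  exact (Submodule.finrank_mono h).trans (Submodule.finrank_add_le_finrank_add_finrank _ _)

theorem mapRank_neg (f : V →ₗ[k] W) : mapRank (-f) = mapRank f := by
  rw [mapRank, mapRank, LinearMap.range_neg]

theorem mapRank_sub_le [FiniteDimensional k W] (f g : V →ₗ[k] W) :
    mapRank (f - g) ≤ mapRank f + mapRank g := by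
  rw [sub_eq_add_neg, ← mapRank_neg g]
  exact mapRank_add_le _ _

theorem mapRank_comp_le_left [FiniteDimensional k W] (f : V →ₗ[k] W) (g : U →ₗ[k] V) :
    mapRank (f ∘ₗ g) ≤ mapRank f :=
  Submodule.finrank_mono (LinearMap.range_comp_le_range g f)

theorem mapRank_comp_le_right [FiniteDimensional k V] (f : V →ₗ[k] W) (g : U →ₗ[k] V) :
    mapRank (f ∘ₗ g) ≤ mapRank g := by
  rw [mapRank, LinearMap.range_comp]
  exact Submodule.finrank_map_le _ _

theorem mapRank_le_domain [FiniteDimensional k V] (f : V →ₗ[k] W) :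
    mapRank f ≤ Module.finrank k V :=
  LinearMap.finrank_range_le f

theorem mapRank_le_codomain [FiniteDimensional k W] (f : V →ₗ[k] W) :
    mapRank f ≤ Module.finrank k W :=
  Submodule.finrank_le _

theorem mapRank_add_le_of_comp_eq_zero [FiniteDimensional k V]
    (f : V →ₗ[k] W) (g : U →ₗ[k] V) (h : f ∘ₗ g = 0) :
    mapRank f + mapRank g ≤ Module.finrank k V := by
  have h1 : LinearMap.range g ≤ LinearMap.ker f := LinearMap.range_le_ker_iff.mpr h
  have h2 := Submodule.finrank_mono h1
  have h3 := LinearMap.finrank_range_add_finrank_ker f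
  unfold mapRank
  omega

end RangeRank

section Decomposition

variable {A : Type*} [Ring A] [Algebra k A] {ι : Type*}

/-- The map `y ↦ ∑ i ∈ T, d i * β i y • c i`. -/
noncomputable def partialSum (β : ι → A →ₗ[k] k) (c : ι → A) (T : Finset ι) (d : ι → k) :
    A →ₗ[k] A :=
  ∑ i ∈ T, d i • (β i).smulRight (c i)

theorem partialSum_apply (β : ι → A →ₗ[k] k) (c : ι → A) (T : Finset ι) (d : ι → k) (y : A) :
    partialSum β c T d y = ∑ i ∈ T, (d i * β i y) • c i := by
  simp [partialSum, mul_smul]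

/-- The map collecting the values of the functionals `β i`, `i ∈ T`. -/
noncomputable def coordMap (β : ι → A →ₗ[k] k) (T : Finset ι) : A →ₗ[k] (T → k) :=
  LinearMap.pi (fun i : T => β i)

/-- The map forming linear combinations of the `c i`, `i ∈ T`. -/
noncomputable def combMap (k : Type*) [Field k] {A : Type*} [Ring A] [Algebra k A]
    {ι : Type*} (c : ι → A) (T : Finset ι) : (T → k) →ₗ[k] A :=
  Fintype.linearCombination k (fun i : T => c i)

/-- Coordinatewise multiplication by `d`. -/
noncomputable def diagMap (T : Finset ι) (d : ι → k) : (T → k) →ₗ[k] (T → k) :=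
  LinearMap.mulLeft k (fun i : T => d i)

theorem partialSum_eq_comp (β : ι → A →ₗ[k] k) (c : ι → A) (T : Finset ι) (d : ι → k) :
    partialSum β c T d = combMap k c T ∘ₗ diagMap T d ∘ₗ coordMap β T := by
  ext y
  rw [partialSum_apply, ← Finset.sum_coe_sort]
  simp [combMap, diagMap, coordMap, Fintype.linearCombination_apply]

theorem diagMap_one (T : Finset ι) : diagMap T (fun _ => (1 : k)) = LinearMap.id := by
  ext; simp [diagMap]

theorem diagMap_comm (T : Finset ι) (d d' : ι → k) :
    diagMap T d ∘ₗ diagMap T d' = diagMap T d' ∘ₗ diagMap T d := by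
  apply LinearMap.ext
  intro v
  funext i
  simp only [diagMap, LinearMap.comp_apply, LinearMap.mulLeft_apply, Pi.mul_apply]
  ring

theorem partialSum_eq_comp_of_one (β : ι → A →ₗ[k] k) (c : ι → A) (T : Finset ι) (d : ι → k)
    (hd : ∀ i ∈ T, d i = 1) :
    partialSum β c T d = combMap k c T ∘ₗ coordMap β T := by
  have : partialSum β c T d = partialSum β c T (fun _ => 1) :=
    Finset.sum_congr rfl fun i hi => by rw [hd i hi]
  rw [this, partialSum_eq_comp, diagMap_one, LinearMap.id_comp]

theorem mapRank_partialSum_le [FiniteDimensional k A] (β : ι → A →ₗ[k] k) (c : ι → A) (T : Finset ι) (d : ι → k) :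
    mapRank (partialSum β c T d) ≤ T.card := by
  rw [partialSum_eq_comp]
  refine (mapRank_comp_le_left _ _).trans ((mapRank_le_domain _).trans ?_)
  simp

/-- The common kernel of the functionals `α i`, `i ∈ K`. -/
noncomputable def flat (α : ι → A →ₗ[k] k) (K : Finset ι) : Submodule k A :=
  LinearMap.ker (coordMap α K)

theorem mem_flat {α : ι → A →ₗ[k] k} {K : Finset ι} {x : A} :
    x ∈ flat α K ↔ ∀ i ∈ K, α i x = 0 := by
  simp [flat, coordMap, funext_iff]

theorem flat_anti {α : ι → A →ₗ[k] k} {K K' : Finset ι} (h : K' ⊆ K) :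
    flat α K ≤ flat α K' := fun _ hx => mem_flat.mpr fun i hi => mem_flat.mp hx i (h hi)

theorem finrank_le_finrank_flat_add_card [FiniteDimensional k A] (α : ι → A →ₗ[k] k) (K : Finset ι) :
    Module.finrank k A ≤ Module.finrank k (flat α K) + K.card := by
  have h1 := LinearMap.finrank_range_add_finrank_ker (coordMap α K)
  have h2 := mapRank_le_codomain (coordMap α K)
  have h3 : Module.finrank k (K → k) = K.card := by simp
  unfold mapRank at h2
  unfold flat
  omega

theorem exists_subset_flat_apply_ne_zero [FiniteDimensional k A] {B : Type*} [AddCommGroup B] [Module k B]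
    (α : ι → A →ₗ[k] k) (K : Finset ι) (L : A →ₗ[k] B) (hL : L ≠ 0) :
    ∃ K' ⊆ K, Module.finrank k (flat α K') ≤ Module.finrank k (flat α K) + 1 ∧
      ∃ x ∈ flat α K', L x ≠ 0 := by
  classical
  set P : Finset (Finset ι) := K.powerset.filter fun K' => ∃ x ∈ flat α K', L x ≠ 0 with hP
  have hne : P.Nonempty := by
    obtain ⟨x, hx⟩ : ∃ x, L x ≠ 0 := by
      by_contra! h
      exact hL (LinearMap.ext h)
    refine ⟨∅, ?_⟩
    rw [hP, Finset.mem_filter]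
    exact ⟨Finset.empty_mem_powerset K, x, mem_flat.mpr (by simp), hx⟩
  obtain ⟨K', hK', hmax⟩ := Finset.exists_max_image P Finset.card hne
  rw [hP, Finset.mem_filter, Finset.mem_powerset] at hK'
  obtain ⟨hsub, x, hx, hLx⟩ := hK'
  refine ⟨K', hsub, ?_, x, hx, hLx⟩
  have hvanish : ∀ i ∈ K, i ∉ K' → ∀ y ∈ flat α K', α i y = 0 → L y = 0 := by
    intro i hi hi' y hy hiy
    by_contra hLy
    have hmem : insert i K' ∈ P := by
      rw [hP, Finset.mem_filter, Finset.mem_powerset]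
      refine ⟨Finset.insert_subset hi hsub, y, mem_flat.mpr ?_, hLy⟩
      intro j hj
      rcases Finset.mem_insert.mp hj with rfl | hj
      · exact hiy
      · exact mem_flat.mp hy j hj
    have := hmax _ hmem
    rw [Finset.card_insert_of_notMem hi'] at this
    omega
  have hle : flat α K' ≤ flat α K ⊔ Submodule.span k {x} := by
    intro y hy
    by_cases hex : ∃ i ∈ K, i ∉ K'
    · obtain ⟨i, hi, hi'⟩ := hex
      have hratio : ∀ j ∈ K, j ∉ K' → α j x ≠ 0 ∧ L y = (α j y / α j x) • L x := by
        intro j hj hj'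
        have hjx : α j x ≠ 0 := fun h => hLx (hvanish j hj hj' x hx h)
        refine ⟨hjx, ?_⟩
        have := hvanish j hj hj' (y - (α j y / α j x) • x)
          (Submodule.sub_mem _ hy (Submodule.smul_mem _ _ hx)) (by
            simp [div_mul_cancel₀ _ hjx])
        rw [map_sub, map_smul] at this
        exact sub_eq_zero.mp this
      set ρ := α i y / α i x with hρ
      have hmem : y - ρ • x ∈ flat α K := by
        rw [mem_flat]
        intro j hj
        by_cases hj' : j ∈ K'
        · rw [map_sub, map_smul, mem_flat.mp hy j hj', mem_flat.mp hx j hj']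
          simp
        · have h1 := (hratio i hi hi').2
          obtain ⟨hjx, h2⟩ := hratio j hj hj'
          rw [h1, ← sub_eq_zero, ← sub_smul, smul_eq_zero, or_iff_left hLx, sub_eq_zero] at h2
          rw [map_sub, map_smul, hρ, h2, smul_eq_mul, div_mul_cancel₀ _ hjx, sub_self]
      rw [← sub_add_cancel y (ρ • x)]
      exact Submodule.add_mem_sup hmem
        (Submodule.smul_mem _ _ (Submodule.mem_span_singleton_self x))
    · push Not at hex
      exact Submodule.mem_sup_left (flat_anti (fun i hi => hex i hi) hy)
  calc Module.finrank k (flat α K') ≤ _ := Submodule.finrank_mono hle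
    _ ≤ _ := Submodule.finrank_add_le_finrank_add_finrank _ _
    _ ≤ _ := by
      gcongr
      simpa using finrank_span_le_card (R := k) ({x} : Set A)

theorem exists_subset_flat_apply_ne_zero₂ [FiniteDimensional k A] {B : Type*} [AddCommGroup B] [Module k B]
    (α : ι → A →ₗ[k] k) (K : Finset ι) (L₁ L₂ : A →ₗ[k] B) (h₁ : L₁ ≠ 0) (h₂ : L₂ ≠ 0) :
    ∃ K' ⊆ K, Module.finrank k (flat α K') ≤ Module.finrank k (flat α K) + 2 ∧
      ∃ x ∈ flat α K', L₁ x ≠ 0 ∧ L₂ x ≠ 0 := by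
  obtain ⟨K₁, hK₁, hd₁, x₁, hx₁, hL₁⟩ := exists_subset_flat_apply_ne_zero α K L₁ h₁
  obtain ⟨K₂, hK₂, hd₂, x₂, hx₂, hL₂⟩ := exists_subset_flat_apply_ne_zero α K₁ L₂ h₂
  refine ⟨K₂, hK₂.trans hK₁, by omega, ?_⟩
  have hx₁' := flat_anti hK₂ hx₁
  by_cases h12 : L₂ x₁ = 0
  · by_cases h21 : L₁ x₂ = 0
    · refine ⟨x₁ + x₂, Submodule.add_mem _ hx₁' hx₂, ?_, ?_⟩
      · rwa [map_add, h21, add_zero]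
      · rwa [map_add, h12, zero_add]
    · exact ⟨x₂, hx₂, h21, hL₂⟩
  · exact ⟨x₁, hx₁', hL₁, h12⟩

/-- Every nonzero right ideal has dimension at least `w`. -/
def RightIdealBound (k A : Type*) [Field k] [Ring A] [Algebra k A] (w : ℕ) : Prop :=
  ∀ N : Submodule k A, (∀ x ∈ N, ∀ a, x * a ∈ N) → N ≠ ⊥ → w ≤ Module.finrank k N

theorem RightIdealBound.le_mapRank {w : ℕ} (hw : RightIdealBound k A w) {v : A} (hv : v ≠ 0) :
    w ≤ mapRank (LinearMap.mulLeft k v) := by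
  apply hw
  · rintro _ ⟨y, rfl⟩ a
    exact ⟨y * a, by simp [mul_assoc]⟩
  · intro h
    have : v ∈ LinearMap.range (LinearMap.mulLeft k v) := ⟨1, by simp⟩
    rw [h] at this
    exact hv (by simpa using this)

variable [Fintype ι]

theorem mulLeft_eq_partialSum {α β : ι → A →ₗ[k] k} {c : ι → A}
    (hdec : ∀ x y, x * y = ∑ i, (α i x * β i y) • c i) (T : Finset ι) (x : A)
    (hx : ∀ i ∉ T, α i x = 0) :
    LinearMap.mulLeft k x = partialSum β c T (fun i => α i x) := by
  ext y
  rw [LinearMap.mulLeft_apply, hdec, partialSum_apply]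
  symm
  apply Finset.sum_subset (Finset.subset_univ T)
  intro i _ hi
  simp [hx i hi]

theorem mulLeft_eq_partialSum_add [DecidableEq ι] {α β : ι → A →ₗ[k] k} {c : ι → A}
    (hdec : ∀ x y, x * y = ∑ i, (α i x * β i y) • c i) (S T : Finset ι) (hST : Disjoint S T) (x : A)
    (hx : ∀ i ∉ S ∪ T, α i x = 0) :
    LinearMap.mulLeft k x =
      partialSum β c S (fun i => α i x) + partialSum β c T (fun i => α i x) := by
  rw [mulLeft_eq_partialSum hdec _ x hx, partialSum, Finset.sum_union hST]
  rfl

theorem mapRank_mulLeft_one : mapRank (LinearMap.mulLeft k (1 : A)) = Module.finrank k A := by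
  rw [LinearMap.mulLeft_one, mapRank, LinearMap.range_id, finrank_top]

theorem mulLeft_one_eq_comp {α β : ι → A →ₗ[k] k} {c : ι → A}
    (hdec : ∀ x y, x * y = ∑ i, (α i x * β i y) • c i) (S : Finset ι)
    (h1 : ∀ i ∈ S, α i 1 = 1) (h0 : ∀ i ∉ S, α i 1 = 0) :
    combMap k c S ∘ₗ coordMap β S = LinearMap.id := by
  rw [← partialSum_eq_comp_of_one β c S (fun i => α i 1) h1,
    ← mulLeft_eq_partialSum hdec S 1 h0, LinearMap.mulLeft_one]

variable [FiniteDimensional k A]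

theorem mapRank_mulLeft_commutator_le [DecidableEq ι] {α β : ι → A →ₗ[k] k} {c : ι → A}
    (hdec : ∀ x y, x * y = ∑ i, (α i x * β i y) • c i) (S T : Finset ι) (hST : Disjoint S T)
    (h1 : ∀ i ∈ S, α i 1 = 1) (h0 : ∀ i ∉ S, α i 1 = 0) (x z : A)
    (hx : ∀ i ∉ S ∪ T, α i x = 0) (hz : ∀ i ∉ S, α i z = 0) :
    mapRank (LinearMap.mulLeft k (x * z - z * x)) + 2 * Module.finrank k A
      ≤ 2 * S.card + 2 * T.card := by
  have hid := mulLeft_one_eq_comp hdec S h1 h0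
  set γ := combMap k c S with hγ
  set b := coordMap β S with hb
  set Dx := diagMap S (fun i => α i x)
  set Dz := diagMap S (fun i => α i z)
  set C := partialSum β c T (fun i => α i x) with hC
  have hX : LinearMap.mulLeft k x = γ ∘ₗ Dx ∘ₗ b + C := by
    rw [mulLeft_eq_partialSum_add hdec S T hST x hx, partialSum_eq_comp]
  have hZ : LinearMap.mulLeft k z = γ ∘ₗ Dz ∘ₗ b := by
    rw [mulLeft_eq_partialSum hdec S z hz, partialSum_eq_comp]
  set P : (S → k) →ₗ[k] (S → k) := LinearMap.id - b ∘ₗ γ with hP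
  have hPγ : mapRank P + Module.finrank k A ≤ S.card := by
    have h := mapRank_add_le_of_comp_eq_zero γ P (by
      rw [hP, LinearMap.comp_sub, LinearMap.comp_id, ← LinearMap.comp_assoc, hid,
        LinearMap.id_comp, sub_self])
    have h2 : Module.finrank k A ≤ mapRank γ := by
      have := mapRank_comp_le_left γ b
      rwa [hid, ← LinearMap.mulLeft_one, mapRank_mulLeft_one] at this
    have h3 : Module.finrank k (S → k) = S.card := by simp
    omega
  have hcomm : Dx ∘ₗ Dz = Dz ∘ₗ Dx := diagMap_comm _ _ _
  have key : LinearMap.mulLeft k (x * z - z * x) =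
      (γ ∘ₗ Dz ∘ₗ P ∘ₗ Dx ∘ₗ b - γ ∘ₗ Dx ∘ₗ P ∘ₗ Dz ∘ₗ b)
        + (C ∘ₗ LinearMap.mulLeft k z - LinearMap.mulLeft k z ∘ₗ C) := by
    have e1 : LinearMap.mulLeft k (x * z - z * x) =
        LinearMap.mulLeft k x ∘ₗ LinearMap.mulLeft k z
          - LinearMap.mulLeft k z ∘ₗ LinearMap.mulLeft k x := by
      ext y; simp [sub_mul, mul_assoc]
    rw [e1, hX, hZ]
    ext y
    have hc : γ (Dz (Dx (b y))) = γ (Dx (Dz (b y))) := by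
      rw [← LinearMap.comp_apply Dz, ← hcomm]; rfl
    simp only [hP, LinearMap.sub_apply, LinearMap.add_apply, LinearMap.comp_apply, map_sub,
      map_add, LinearMap.id_apply, hc]
    abel
  have r1 : mapRank (γ ∘ₗ Dz ∘ₗ P ∘ₗ Dx ∘ₗ b) ≤ mapRank P :=
    (mapRank_comp_le_right _ _).trans
      ((mapRank_comp_le_right _ _).trans (mapRank_comp_le_left _ _))
  have r2 : mapRank (γ ∘ₗ Dx ∘ₗ P ∘ₗ Dz ∘ₗ b) ≤ mapRank P :=
    (mapRank_comp_le_right _ _).trans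
      ((mapRank_comp_le_right _ _).trans (mapRank_comp_le_left _ _))
  have rC : mapRank C ≤ T.card := mapRank_partialSum_le _ _ _ _
  have r3 : mapRank (C ∘ₗ LinearMap.mulLeft k z) ≤ mapRank C := mapRank_comp_le_left _ _
  have r4 : mapRank (LinearMap.mulLeft k z ∘ₗ C) ≤ mapRank C := mapRank_comp_le_right _ _
  have s1 := mapRank_sub_le (γ ∘ₗ Dz ∘ₗ P ∘ₗ Dx ∘ₗ b) (γ ∘ₗ Dx ∘ₗ P ∘ₗ Dz ∘ₗ b)
  have s2 := mapRank_sub_le (C ∘ₗ LinearMap.mulLeft k z) (LinearMap.mulLeft k z ∘ₗ C)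
  have s3 := mapRank_add_le (γ ∘ₗ Dz ∘ₗ P ∘ₗ Dx ∘ₗ b - γ ∘ₗ Dx ∘ₗ P ∘ₗ Dz ∘ₗ b)
    (C ∘ₗ LinearMap.mulLeft k z - LinearMap.mulLeft k z ∘ₗ C)
  rw [← key] at s3
  omega

theorem mapRank_mulLeft_corner_le [DecidableEq ι] {α β : ι → A →ₗ[k] k} {c : ι → A}
    (hdec : ∀ x y, x * y = ∑ i, (α i x * β i y) • c i) (S₀ S₁ T : Finset ι)
    (h01 : Disjoint S₀ S₁) (hT : Disjoint (S₀ ∪ S₁) T) (e f : A)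
    (he1 : ∀ i ∈ S₁, α i e = 1) (he0 : ∀ i ∉ S₁, α i e = 0)
    (hf1 : ∀ i ∈ S₀, α i f = 1) (hf0 : ∀ i ∉ S₀, α i f = 0)
    (hef : e * f = 0) (x : A) (hx : ∀ i ∉ S₀ ∪ S₁ ∪ T, α i x = 0) :
    mapRank (LinearMap.mulLeft k (e * x * f)) + mapRank (LinearMap.mulLeft k e)
      + mapRank (LinearMap.mulLeft k f) ≤ S₀.card + S₁.card + T.card := by
  set lf := LinearMap.mulLeft k f
  set le := LinearMap.mulLeft k e
  have hE : le = combMap k c S₁ ∘ₗ coordMap β S₁ := by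
    rw [← partialSum_eq_comp_of_one β c S₁ (fun i => α i e) he1,
      ← mulLeft_eq_partialSum hdec S₁ e he0]
  have hF : lf = combMap k c S₀ ∘ₗ coordMap β S₀ := by
    rw [← partialSum_eq_comp_of_one β c S₀ (fun i => α i f) hf1,
      ← mulLeft_eq_partialSum hdec S₀ f hf0]
  have hEF : le ∘ₗ lf = 0 := by
    ext y; simp [le, lf, ← mul_assoc, hef]
  set D₀ := diagMap S₀ (fun i => α i x)
  set D₁ := diagMap S₁ (fun i => α i x)
  set C := partialSum β c T (fun i => α i x) with hC
  have hX : LinearMap.mulLeft k x = combMap k c S₀ ∘ₗ D₀ ∘ₗ coordMap β S₀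
      + combMap k c S₁ ∘ₗ D₁ ∘ₗ coordMap β S₁ + C := by
    rw [mulLeft_eq_partialSum_add hdec (S₀ ∪ S₁) T hT x hx, partialSum, Finset.sum_union h01,
      ← partialSum, ← partialSum, partialSum_eq_comp, partialSum_eq_comp]
  have key : LinearMap.mulLeft k (e * x * f) =
      (le ∘ₗ combMap k c S₀) ∘ₗ D₀ ∘ₗ coordMap β S₀ ∘ₗ lf
      + (le ∘ₗ combMap k c S₁ ∘ₗ D₁) ∘ₗ coordMap β S₁ ∘ₗ lf + le ∘ₗ C ∘ₗ lf := by
    have e1 : LinearMap.mulLeft k (e * x * f) = le ∘ₗ LinearMap.mulLeft k x ∘ₗ lf := by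
      ext y; simp [le, lf, mul_assoc]
    rw [e1, hX]
    ext y
    simp only [LinearMap.add_apply, LinearMap.comp_apply, map_add]
  have c0 : Module.finrank k (S₀ → k) = S₀.card := by simp
  have c1 : Module.finrank k (S₁ → k) = S₁.card := by simp
  have r0 : mapRank (le ∘ₗ combMap k c S₀) + mapRank lf ≤ S₀.card := by
    have h := mapRank_add_le_of_comp_eq_zero (le ∘ₗ combMap k c S₀) (coordMap β S₀) (by
      rw [LinearMap.comp_assoc, ← hF, hEF])
    have h2 : mapRank lf ≤ mapRank (coordMap β S₀) := by
      rw [hF]; exact mapRank_comp_le_right _ _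
    omega
  have r1 : mapRank (coordMap β S₁ ∘ₗ lf) + mapRank le ≤ S₁.card := by
    have h := mapRank_add_le_of_comp_eq_zero (combMap k c S₁) (coordMap β S₁ ∘ₗ lf) (by
      rw [← LinearMap.comp_assoc, ← hE, hEF])
    have h2 : mapRank le ≤ mapRank (combMap k c S₁) := by
      rw [hE]; exact mapRank_comp_le_left _ _
    omega
  have rC : mapRank C ≤ T.card := mapRank_partialSum_le _ _ _ _
  have r2 : mapRank (le ∘ₗ C ∘ₗ lf) ≤ mapRank C :=
    (mapRank_comp_le_right _ _).trans (mapRank_comp_le_left _ _)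
  have s1 : mapRank ((le ∘ₗ combMap k c S₀) ∘ₗ D₀ ∘ₗ coordMap β S₀ ∘ₗ lf)
      ≤ mapRank (le ∘ₗ combMap k c S₀) := mapRank_comp_le_left _ _
  have s2 : mapRank ((le ∘ₗ combMap k c S₁ ∘ₗ D₁) ∘ₗ coordMap β S₁ ∘ₗ lf)
      ≤ mapRank (coordMap β S₁ ∘ₗ lf) := mapRank_comp_le_right _ _
  have s3 := mapRank_add_le ((le ∘ₗ combMap k c S₀) ∘ₗ D₀ ∘ₗ coordMap β S₀ ∘ₗ lf)
    ((le ∘ₗ combMap k c S₁ ∘ₗ D₁) ∘ₗ coordMap β S₁ ∘ₗ lf)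
  have s4 := mapRank_add_le ((le ∘ₗ combMap k c S₀) ∘ₗ D₀ ∘ₗ coordMap β S₀ ∘ₗ lf
    + (le ∘ₗ combMap k c S₁ ∘ₗ D₁) ∘ₗ coordMap β S₁ ∘ₗ lf) (le ∘ₗ C ∘ₗ lf)
  rw [← key] at s4
  omega

section PrimeAlgebra

theorem exists_rightIdealBound [Nontrivial A]
    (hprime : ∀ a b : A, (∀ x, a * x * b = 0) → a = 0 ∨ b = 0) :
    ∃ w, RightIdealBound k A w ∧ Module.finrank k A ≤ w * w := by
  classical
  have hex : ∃ w, ∃ N : Submodule k A, (∀ x ∈ N, ∀ a, x * a ∈ N) ∧ N ≠ ⊥ ∧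
      Module.finrank k N = w :=
    ⟨_, ⊤, fun _ _ _ => trivial, top_ne_bot, rfl⟩
  obtain ⟨N, hN, hN0, hw⟩ := Nat.find_spec hex
  refine ⟨Nat.find hex, fun M hM hM0 => Nat.find_min' hex ⟨M, hM, hM0, rfl⟩, ?_⟩
  rw [← hw, ← Module.finrank_linearMap k k N N]
  let Φ : A →ₗ[k] (N →ₗ[k] N) :=
    { toFun := fun a => (LinearMap.mulRight k a).restrict (fun x hx => hN x hx a)
      map_add' := fun a b => by
        ext x
        exact mul_add (x : A) a b
      map_smul' := fun t a => by
        ext x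
        exact mul_smul_comm t (x : A) a }
  apply LinearMap.finrank_le_finrank_of_injective (f := Φ)
  rw [injective_iff_map_eq_zero]
  intro a ha
  obtain ⟨e, he, he0⟩ := Submodule.exists_mem_ne_zero_of_ne_bot hN0
  refine (hprime e a fun x => ?_).resolve_left he0
  have h := LinearMap.congr_fun ha ⟨e * x, hN e he x⟩
  exact congrArg Subtype.val h

theorem exists_mul_eq_zero_of_not_isUnit (k : Type*) {A : Type*} [Field k] [Ring A]
    [Algebra k A] [FiniteDimensional k A] {a : A} (ha : ¬ IsUnit a) : ∃ y ≠ 0, a * y = 0 := by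
  by_contra! h
  apply ha
  have hinj : Function.Injective (LinearMap.mulLeft k a) := by
    rw [injective_iff_map_eq_zero]
    intro y hy
    by_contra hy0
    exact h y hy0 hy
  obtain ⟨b, hb⟩ := LinearMap.injective_iff_surjective.mp hinj 1
  rw [LinearMap.mulLeft_apply] at hb
  refine ⟨⟨a, b, hb, hinj ?_⟩, rfl⟩
  simp [← mul_assoc, hb]

theorem exists_mul_left_eq_zero_of_not_isUnit (k : Type*) {A : Type*} [Field k] [Ring A]
    [Algebra k A] [FiniteDimensional k A] {a : A} (ha : ¬ IsUnit a) : ∃ y ≠ 0, y * a = 0 := by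
  by_contra! h
  apply ha
  have hinj : Function.Injective (LinearMap.mulRight k a) := by
    rw [injective_iff_map_eq_zero]
    intro y hy
    by_contra hy0
    exact h y hy0 hy
  obtain ⟨b, hb⟩ := LinearMap.injective_iff_surjective.mp hinj 1
  rw [LinearMap.mulRight_apply] at hb
  refine ⟨⟨a, b, hinj ?_, hb⟩, rfl⟩
  simp [mul_assoc, hb]

theorem RightIdealBound.two_mul_le_mapRank {w : ℕ} (hw : RightIdealBound k A w) {v p r s : A}
    (h0 : p * v * r = 0) (h1 : v * r ≠ 0) (h2 : p * v * s ≠ 0) :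
    2 * w ≤ mapRank (LinearMap.mulLeft k v) := by
  set R := LinearMap.range (LinearMap.mulLeft k v) with hR
  set f := (LinearMap.mulLeft k p).domRestrict R with hf
  have hRr : ∀ y, v * y ∈ R := fun y => ⟨y, rfl⟩
  have e1 : w ≤ Module.finrank k (LinearMap.range f) := by
    apply hw
    · rintro _ ⟨⟨_, ⟨y, rfl⟩⟩, rfl⟩ a
      exact ⟨⟨v * (y * a), hRr _⟩, by simp [hf, mul_assoc]⟩
    · intro h
      have : p * v * s ∈ LinearMap.range f := ⟨⟨v * s, hRr s⟩, by simp [hf, mul_assoc]⟩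
      rw [h] at this
      exact h2 (by simpa using this)
  have e2 : w ≤ Module.finrank k ((LinearMap.ker f).map R.subtype) := by
    apply hw
    · rintro _ ⟨⟨_, ⟨y, rfl⟩⟩, hy, rfl⟩ a
      refine ⟨⟨v * (y * a), hRr _⟩, ?_, by simp [mul_assoc]⟩
      have hy' : p * (v * y) = 0 := hy
      change p * (v * (y * a)) = 0
      rw [← mul_assoc v, ← mul_assoc p, hy', zero_mul]
    · intro h
      have : v * r ∈ (LinearMap.ker f).map R.subtype :=
        ⟨⟨v * r, hRr r⟩, by
          change p * (v * r) = 0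
          rw [← mul_assoc, h0], rfl⟩
      rw [h] at this
      exact h1 (by simpa using this)
  rw [Submodule.finrank_map_subtype_eq] at e2
  have h3 := LinearMap.finrank_range_add_finrank_ker f
  rw [mapRank, ← hR]
  omega

theorem finrank_sup_of_disjoint {N M : Submodule k A} (h : Disjoint N M) :
    Module.finrank k (N ⊔ M : Submodule k A) = Module.finrank k N + Module.finrank k M := by
  have := Submodule.finrank_sup_add_finrank_inf_eq N M
  rw [h.eq_bot, finrank_bot] at this
  omega

theorem RightIdealBound.card_mul_le {w : ℕ} (hw : RightIdealBound k A w) (z : A) (Λ : Finset k)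
    (hΛ : ∀ μ ∈ Λ, ∃ y ≠ 0, z * y = μ • y) : Λ.card * w ≤ Module.finrank k A := by
  classical
  set f : Module.End k A := LinearMap.mulLeft k z with hf
  have hind := Module.End.eigenspaces_iSupIndep f
  have hdim : ∀ μ ∈ Λ, w ≤ Module.finrank k (f.eigenspace μ) := by
    intro μ hμ
    apply hw
    · intro x hx a
      rw [Module.End.mem_eigenspace_iff] at hx ⊢
      rw [hf, LinearMap.mulLeft_apply] at hx ⊢
      rw [← mul_assoc, hx, smul_mul_assoc]
    · obtain ⟨y, hy, hzy⟩ := hΛ μ hμ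
      intro h
      have : y ∈ f.eigenspace μ := Module.End.mem_eigenspace_iff.mpr hzy
      rw [h] at this
      exact hy (by simpa using this)
  have key : ∀ M ⊆ Λ, M.card * w ≤ Module.finrank k (M.sup f.eigenspace : Submodule k A) := by
    intro M
    induction M using Finset.induction_on with
    | empty => simp
    | insert μ M hμ ih =>
      intro hM
      have hdis : Disjoint (f.eigenspace μ) (M.sup f.eigenspace) :=
        (hind μ).mono_right (Finset.sup_le fun ν hν =>
          le_iSup₂_of_le ν (by rintro rfl; exact hμ hν) le_rfl)
      rw [Finset.card_insert_of_notMem hμ, Finset.sup_insert, 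
        finrank_sup_of_disjoint hdis]
      have := ih ((Finset.subset_insert _ _).trans hM)
      have := hdim μ (hM (Finset.mem_insert_self _ _))
      linarith
  exact (key Λ subset_rfl).trans (Submodule.finrank_le _)

end PrimeAlgebra

theorem RightIdealBound.le_finrank_flat [DecidableEq ι]
    (hprime : ∀ a b : A, (∀ x, a * x * b = 0) → a = 0 ∨ b = 0)
    {w : ℕ} (hw : RightIdealBound k A w) {α β : ι → A →ₗ[k] k} {c : ι → A}
    (hdec : ∀ x y, x * y = ∑ i, (α i x * β i y) • c i) (S : Finset ι)
    (h1 : ∀ i ∈ S, α i 1 = 1) (h0 : ∀ i ∉ S, α i 1 = 0)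
    (hcard : Fintype.card ι + 2 ≤ 2 * Module.finrank k A)
    {z : A} (hz : ∀ i ∉ S, α i z = 0) {μ ν : k} (hμν : μ ≠ ν) {p p' s s' : A}
    (hp : p ≠ 0) (hp' : p' ≠ 0) (hs : s ≠ 0) (hs' : s' ≠ 0)
    (hzp : p * z = μ • p) (hzp' : z * p' = μ • p')
    (hzs : s * z = ν • s) (hzs' : z * s' = ν • s') :
    w ≤ Module.finrank k (flat α Sᶜ) := by
  have hne : ∀ a b : A, a ≠ 0 → b ≠ 0 →
      LinearMap.mulLeft k a ∘ₗ LinearMap.mulRight k b ≠ 0 := by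
    intro a b ha hb h
    rcases hprime a b (fun x => by
      have := LinearMap.congr_fun h x
      simpa [mul_assoc] using this) with h | h
    exacts [ha h, hb h]
  obtain ⟨K', hK', hd, x, hx, hx1, hx2⟩ := exists_subset_flat_apply_ne_zero₂ α Sᶜ
    _ _ (hne p s' hp hs') (hne s p' hs hp')
  simp only [LinearMap.comp_apply, LinearMap.mulLeft_apply, LinearMap.mulRight_apply] at hx1 hx2
  have hvan : ∀ i ∉ S ∪ (Sᶜ \ K'), α i x = 0 := by
    intro i hi
    apply mem_flat.mp hx
    simp only [Finset.mem_union, Finset.mem_sdiff, Finset.mem_compl] at hi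
    tauto
  have hST : Disjoint S (Sᶜ \ K') :=
    disjoint_compl_right.mono_right Finset.sdiff_subset
  have hub := mapRank_mulLeft_commutator_le hdec S (Sᶜ \ K') hST h1 h0 x z hvan hz
  have hlb : 2 * w ≤ mapRank (LinearMap.mulLeft k (x * z - z * x)) := by
    have e1 : p * (x * z - z * x) * s' = (ν - μ) • (p * (x * s')) := by
      have : p * (x * z - z * x) * s' = p * x * (z * s') - (p * z) * x * s' := by noncomm_ring
      rw [this, hzs', hzp, sub_smul]
      simp [mul_assoc]
    have e2 : s * (x * z - z * x) * p' = (μ - ν) • (s * (x * p')) := by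
      have : s * (x * z - z * x) * p' = s * x * (z * p') - (s * z) * x * p' := by noncomm_ring
      rw [this, hzp', hzs, sub_smul]
      simp [mul_assoc]
    have e3 : s * (x * z - z * x) * s' = 0 := by
      have : s * (x * z - z * x) * s' = s * x * (z * s') - (s * z) * x * s' := by noncomm_ring
      rw [this, hzs', hzs]
      simp [mul_assoc]
    refine hw.two_mul_le_mapRank e3 ?_ (s := p') ?_
    · intro h
      rw [mul_assoc, h, mul_zero] at e1
      exact (smul_ne_zero (sub_ne_zero.mpr hμν.symm) hx1) e1.symm
    · rw [e2]
      exact smul_ne_zero (sub_ne_zero.mpr hμν) hx2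
  have hn := finrank_le_finrank_flat_add_card α K'
  have hc1 := Finset.card_sdiff_add_card_eq_card hK'
  have hc2 := Finset.card_add_card_compl S
  omega

theorem RightIdealBound.lt_finrank_flat [DecidableEq ι]
    (hprime : ∀ a b : A, (∀ x, a * x * b = 0) → a = 0 ∨ b = 0)
    {w : ℕ} (hw : RightIdealBound k A w) {α β : ι → A →ₗ[k] k} {c : ι → A}
    (hdec : ∀ x y, x * y = ∑ i, (α i x * β i y) • c i) (S S₀ S₁ : Finset ι)
    (hS : S = S₀ ∪ S₁) (h01 : Disjoint S₀ S₁) (hS₀ : S₀.Nonempty) (hS₁ : S₁.Nonempty)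
    (h1 : ∀ i ∈ S, α i 1 = 1) (h0 : ∀ i ∉ S, α i 1 = 0)
    (hcard : Fintype.card ι + 2 ≤ 2 * Module.finrank k A)
    {e : A} (he1 : ∀ i ∈ S₁, α i e = 1) (he0 : ∀ i ∉ S₁, α i e = 0) :
    w < Module.finrank k (flat α Sᶜ) := by
  by_contra! hqw
  have hf1 : ∀ i ∈ S₀, α i (1 - e) = 1 := by
    intro i hi
    rw [map_sub, h1 i (hS ▸ Finset.mem_union_left _ hi), he0 i (Finset.disjoint_left.mp h01 hi),
      sub_zero]
  have hf0 : ∀ i ∉ S₀, α i (1 - e) = 0 := by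
    intro i hi
    by_cases hi' : i ∈ S₁
    · rw [map_sub, h1 i (hS ▸ Finset.mem_union_right _ hi'), he1 i hi', sub_self]
    · rw [map_sub, h0 i (by simp [hS, hi, hi']), he0 i hi', sub_self]
  have hre : mapRank (LinearMap.mulLeft k e) ≤ S₁.card := by
    rw [mulLeft_eq_partialSum hdec S₁ e he0]
    exact mapRank_partialSum_le _ _ _ _
  have hrf : mapRank (LinearMap.mulLeft k (1 - e)) ≤ S₀.card := by
    rw [mulLeft_eq_partialSum hdec S₀ (1 - e) hf0]
    exact mapRank_partialSum_le _ _ _ _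
  have hsum : Module.finrank k A ≤
      mapRank (LinearMap.mulLeft k e) + mapRank (LinearMap.mulLeft k (1 - e)) := by
    have := mapRank_add_le (LinearMap.mulLeft k e) (LinearMap.mulLeft k (1 - e))
    have h2 : LinearMap.mulLeft k e + LinearMap.mulLeft k (1 - e) = LinearMap.mulLeft k 1 := by
      ext y
      simp [sub_mul]
    rwa [h2, mapRank_mulLeft_one] at this
  have hScard : S.card = S₀.card + S₁.card := by rw [hS, Finset.card_union_of_disjoint h01]
  have hc2 := Finset.card_add_card_compl S
  have hnS := finrank_le_finrank_flat_add_card α Sᶜ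
  have hidem : e * (1 - e) = 0 := by
    by_contra hne
    have hw' := hw (LinearMap.range (LinearMap.mulLeft k e) ⊓
      LinearMap.range (LinearMap.mulLeft k (1 - e))) (by
        rintro x ⟨⟨y, rfl⟩, ⟨y', hy'⟩⟩ a
        refine ⟨⟨y * a, by simp [mul_assoc]⟩, ⟨y' * a, ?_⟩⟩
        rw [← hy']
        simp [mul_assoc]) (by
        intro h
        have hmem : e * (1 - e) ∈ LinearMap.range (LinearMap.mulLeft k e) ⊓
            LinearMap.range (LinearMap.mulLeft k (1 - e)) :=
          ⟨⟨1 - e, rfl⟩, ⟨e, by simp [mul_sub, sub_mul]⟩⟩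
        rw [h] at hmem
        exact hne (by simpa using hmem))
    have hdim := Submodule.finrank_sup_add_finrank_inf_eq (LinearMap.range (LinearMap.mulLeft k e))
      (LinearMap.range (LinearMap.mulLeft k (1 - e)))
    have htop : LinearMap.range (LinearMap.mulLeft k e) ⊔
        LinearMap.range (LinearMap.mulLeft k (1 - e)) = ⊤ := by
      rw [eq_top_iff]
      intro y _
      have : y = e * y + (1 - e) * y := by noncomm_ring
      rw [this]
      exact Submodule.add_mem_sup ⟨y, rfl⟩ ⟨y, rfl⟩
    rw [htop, finrank_top] at hdim
    unfold mapRank at hre hrf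
    omega
  have he : e ≠ 0 := by
    rintro rfl
    obtain ⟨i, hi⟩ := hS₁
    simpa using he1 i hi
  have hf : 1 - e ≠ 0 := by
    intro h
    obtain ⟨i, hi⟩ := hS₀
    have := hf1 i hi
    rw [h, map_zero] at this
    exact zero_ne_one this
  have hL : LinearMap.mulLeft k e ∘ₗ LinearMap.mulRight k (1 - e) ≠ 0 := by
    intro h
    rcases hprime e (1 - e) (fun x => by
      have := LinearMap.congr_fun h x
      rw [mul_assoc]
      exact this) with h | h
    exacts [he h, hf h]
  obtain ⟨K', hK', hd, x, hx, hx1⟩ := exists_subset_flat_apply_ne_zero α Sᶜ _ hL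
  have hv : e * x * (1 - e) ≠ 0 := by
    rw [mul_assoc]
    exact hx1
  have hlb := hw.le_mapRank hv
  have hT : Disjoint (S₀ ∪ S₁) (Sᶜ \ K') := by
    rw [← hS]
    exact disjoint_compl_right.mono_right Finset.sdiff_subset
  have hub := mapRank_mulLeft_corner_le hdec S₀ S₁ (Sᶜ \ K') h01 hT e (1 - e) he1 he0 hf1 hf0
    hidem x (by
      intro i hi
      apply mem_flat.mp hx
      rw [← hS] at hi
      simp only [Finset.mem_union, Finset.mem_sdiff, Finset.mem_compl] at hi
      tauto)
  have hn := finrank_le_finrank_flat_add_card α K'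
  have hc1 := Finset.card_sdiff_add_card_eq_card hK'
  omega

theorem exists_separating_vector [Infinite k] {V : Type*} [AddCommGroup V] [Module k V]
    (φ : ι → V →ₗ[k] k) : ∃ z, ∀ i j, φ i z = φ j z → φ i = φ j := by
  classical
  set s : Finset (Submodule k V) :=
    (Finset.univ.image fun ij : ι × ι => LinearMap.ker (φ ij.1 - φ ij.2)).erase ⊤ with hs
  have h := Subspace.biUnion_ne_univ_of_top_notMem (s := s) (by simp [hs])
  obtain ⟨z, hz⟩ := (Set.ne_univ_iff_exists_notMem _).mp h
  refine ⟨z, fun i j hij => ?_⟩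
  by_contra hne
  apply hz
  simp only [Set.mem_iUnion]
  refine ⟨LinearMap.ker (φ i - φ j), ?_, ?_⟩
  · rw [hs, Finset.mem_erase]
    refine ⟨fun h => hne (sub_eq_zero.mp (LinearMap.ker_eq_top.mp h)), ?_⟩
    exact Finset.mem_image.mpr ⟨(i, j), Finset.mem_univ _, rfl⟩
  · simp [hij]

theorem two_mul_finrank_le_of_normalized [Infinite k] [Nontrivial A] [DecidableEq ι]
    (hprime : ∀ a b : A, (∀ x, a * x * b = 0) → a = 0 ∨ b = 0)
    {α β : ι → A →ₗ[k] k} {c : ι → A}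
    (hdec : ∀ x y, x * y = ∑ i, (α i x * β i y) • c i) (S : Finset ι)
    (h1 : ∀ i ∈ S, α i 1 = 1) (h0 : ∀ i ∉ S, α i 1 = 0)
    (hmax : ∀ i ∈ S, ∀ x, (∀ j ∉ S, α j x = 0) → α i x = 0 → ¬ IsUnit x) :
    2 * Module.finrank k A ≤ Fintype.card ι + 1 := by
  classical
  by_contra! hlt
  have hcard : Fintype.card ι + 2 ≤ 2 * Module.finrank k A := by omega
  have hsep : ∀ x, (∀ i, α i x = 0) → x = 0 := by
    intro x hx
    rw [← mul_one x, hdec]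
    simp [hx]
  obtain ⟨w, hw, hnw⟩ := exists_rightIdealBound (k := k) hprime
  have hn : 0 < Module.finrank k A := Module.finrank_pos
  have hw0 : 0 < w := by
    rcases Nat.eq_zero_or_pos w with rfl | h
    · omega
    · exact h
  set Q := flat α Sᶜ with hQ
  have hQmem : ∀ {x}, x ∈ Q ↔ ∀ i ∉ S, α i x = 0 := by
    intro x
    simp [hQ, mem_flat]
  have hq2 : 2 ≤ Module.finrank k Q := by
    have e1 := finrank_le_finrank_flat_add_card α Sᶜ
    have e2 := Finset.card_add_card_compl S
    have e3 : Module.finrank k A ≤ S.card := by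
      have := mapRank_partialSum_le β c S (fun i => α i 1)
      rwa [← mulLeft_eq_partialSum hdec S 1 h0, mapRank_mulLeft_one] at this
    rw [← hQ] at e1
    omega
  obtain ⟨⟨z, hzQ⟩, hz⟩ := exists_separating_vector (fun i => (α i).domRestrict Q)
  have hzS := hQmem.mp hzQ
  set Λ := S.image (fun i => α i z) with hΛ
  have hnonunit : ∀ μ ∈ Λ, ¬ IsUnit (z - μ • 1) := by
    intro μ hμ
    obtain ⟨i, hi, rfl⟩ := Finset.mem_image.mp hμ
    refine hmax i hi _ (fun j hj => ?_) ?_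
    · simp [hzS j hj, h0 j hj]
    · simp [h1 i hi]
  have heig : ∀ μ ∈ Λ, ∃ y ≠ 0, z * y = μ • y := by
    intro μ hμ
    obtain ⟨y, hy, h⟩ := exists_mul_eq_zero_of_not_isUnit k (hnonunit μ hμ)
    refine ⟨y, hy, ?_⟩
    rwa [sub_mul, smul_mul_assoc, one_mul, sub_eq_zero] at h
  have heig' : ∀ μ ∈ Λ, ∃ y ≠ 0, y * z = μ • y := by
    intro μ hμ
    obtain ⟨y, hy, h⟩ := exists_mul_left_eq_zero_of_not_isUnit k (hnonunit μ hμ)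
    refine ⟨y, hy, ?_⟩
    rwa [mul_sub, mul_smul_comm, mul_one, sub_eq_zero] at h
  have htw : Λ.card ≤ w :=
    Nat.le_of_mul_le_mul_right ((hw.card_mul_le z Λ heig).trans hnw) hw0
  have hsec : ∀ μ : Λ, ∃ i ∈ S, α i z = μ := fun μ => Finset.mem_image.mp μ.2
  choose σ hσS hσ using hsec
  have hσα : ∀ i (hi : i ∈ S), ∀ x ∈ Q,
      α (σ ⟨α i z, Finset.mem_image_of_mem _ hi⟩) x = α i x := by
    intro i hi x hx
    have := hz (σ ⟨α i z, Finset.mem_image_of_mem _ hi⟩) i (hσ _)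
    exact LinearMap.congr_fun this ⟨x, hx⟩
  set Ψ : Q →ₗ[k] (Λ → k) := LinearMap.pi (fun μ => (α (σ μ)).domRestrict Q) with hΨ
  have hinj : Function.Injective Ψ := by
    rw [injective_iff_map_eq_zero]
    rintro ⟨x, hx⟩ hx0
    rw [Submodule.mk_eq_zero]
    apply hsep
    intro i
    by_cases hi : i ∈ S
    · rw [← hσα i hi x hx]
      exact congrFun hx0 ⟨α i z, Finset.mem_image_of_mem _ hi⟩
    · exact hQmem.mp hx i hi
  have hΛdim : Module.finrank k (Λ → k) = Λ.card := by simp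
  have hqt := LinearMap.finrank_le_finrank_of_injective hinj
  have ht2 : 1 < Λ.card := by omega
  obtain ⟨μ, hμ, ν, hν, hμν⟩ := Finset.one_lt_card.mp ht2
  obtain ⟨p, hp, hzp⟩ := heig' μ hμ
  obtain ⟨p', hp', hzp'⟩ := heig μ hμ
  obtain ⟨s, hs, hzs⟩ := heig' ν hν
  obtain ⟨s', hs', hzs'⟩ := heig ν hν
  have hwq := hw.le_finrank_flat hprime hdec S h1 h0 hcard hzS hμν hp hp' hs hs' hzp hzp' hzs hzs'
  rw [← hQ] at hwq
  have hsurj : Function.Surjective Ψ :=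
    (LinearMap.injective_iff_surjective_of_finrank_eq_finrank (by omega)).mp hinj
  obtain ⟨⟨e, heQ⟩, he⟩ := hsurj (fun κ => if (κ : k) = μ then 1 else 0)
  have heS : ∀ i ∈ S, α i e = if α i z = μ then 1 else 0 := by
    intro i hi
    rw [← hσα i hi e heQ]
    exact congrFun he ⟨α i z, Finset.mem_image_of_mem _ hi⟩
  have hgt := hw.lt_finrank_flat hprime hdec S (S.filter fun i => ¬ α i z = μ)
    (S.filter fun i => α i z = μ)
    (by rw [Finset.union_comm, Finset.filter_union_filter_not_eq])
    (Finset.disjoint_filter_filter_not S S _).symm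
    (by
      obtain ⟨i, hi, h⟩ := Finset.mem_image.mp hν
      exact ⟨i, Finset.mem_filter.mpr ⟨hi, by rw [h]; exact hμν.symm⟩⟩)
    (by
      obtain ⟨i, hi, h⟩ := Finset.mem_image.mp hμ
      exact ⟨i, Finset.mem_filter.mpr ⟨hi, h⟩⟩)
    h1 h0 hcard (e := e)
    (fun i hi => by
      rw [Finset.mem_filter] at hi
      rw [heS i hi.1, if_pos hi.2])
    (fun i hi => by
      by_cases hiS : i ∈ S
      · rw [heS i hiS, if_neg fun h => hi (Finset.mem_filter.mpr ⟨hiS, h⟩)]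
      · exact hQmem.mp heQ i hiS)
  rw [← hQ] at hgt
  omega

theorem two_mul_finrank_le_of_infinite [Infinite k] [Nontrivial A]
    (hprime : ∀ a b : A, (∀ x, a * x * b = 0) → a = 0 ∨ b = 0)
    {α β : ι → A →ₗ[k] k} {c : ι → A}
    (hdec : ∀ x y, x * y = ∑ i, (α i x * β i y) • c i) :
    2 * Module.finrank k A ≤ Fintype.card ι + 1 := by
  classical
  set P : Finset (Finset ι) := Finset.univ.filter fun K => ∃ u : Aˣ, ∀ i ∈ K, α i u = 0 with hP
  have hmemP : ∀ K, K ∈ P ↔ ∃ u : Aˣ, ∀ i ∈ K, α i u = 0 := fun K => by simp [hP]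
  obtain ⟨K, hK, hmax⟩ := Finset.exists_max_image P Finset.card ⟨∅, (hmemP _).mpr ⟨1, by simp⟩⟩
  obtain ⟨u, hu⟩ := (hmemP K).mp hK
  have hunit : ∀ i ∉ K, ∀ v : Aˣ, (∀ j ∈ K, α j v = 0) → α i v ≠ 0 := by
    intro i hi v hv hiv
    have := hmax (insert i K) ((hmemP _).mpr ⟨v, by
      intro j hj
      rcases Finset.mem_insert.mp hj with rfl | hj
      exacts [hiv, hv j hj]⟩)
    rw [Finset.card_insert_of_notMem hi] at this
    omega
  set κ : ι → k := fun i => if i ∈ K then 1 else (α i u)⁻¹ with hκ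
  have hκ0 : ∀ i, κ i ≠ 0 := by
    intro i
    by_cases hi : i ∈ K
    · simp [hκ, hi]
    · simpa [hκ, hi] using hunit i hi u hu
  refine two_mul_finrank_le_of_normalized hprime
    (α := fun i => κ i • α i ∘ₗ LinearMap.mulLeft k (u : A)) (β := β)
    (c := fun i => (κ i)⁻¹ • (((u⁻¹ : Aˣ) : A) * c i)) ?_ Kᶜ ?_ ?_ ?_
  · intro x y
    have h : x * y = ((u⁻¹ : Aˣ) : A) * ((u * x) * y) := by simp [mul_assoc]
    rw [h, hdec (u * x) y, Finset.mul_sum]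
    refine Finset.sum_congr rfl fun i _ => ?_
    rw [mul_smul_comm, smul_smul]
    congr 1
    simp only [LinearMap.smul_apply, LinearMap.comp_apply, LinearMap.mulLeft_apply, smul_eq_mul]
    field_simp [hκ0 i]
  · intro i hi
    rw [Finset.mem_compl] at hi
    simp [hκ, hi, hunit i hi u hu]
  · intro i hi
    rw [Finset.mem_compl, not_not] at hi
    simp [hu i hi]
  · intro i hi x hx hix hxu
    rw [Finset.mem_compl] at hi
    obtain ⟨v, rfl⟩ := hxu
    refine hunit i hi (u * v) (fun j hj => ?_) ?_
    · have := hx j (by simpa using hj)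
      simpa [hκ0 j] using this
    · simpa [hκ0 i] using hix

end Decomposition

section BaseChange

open TensorProduct Polynomial

theorem eq_zero_or_eq_zero_of_simple {A : Type*} [Ring A] [Algebra k A]
    (hsimple : ∀ I : Submodule k A, (∀ a x, x ∈ I → a * x ∈ I) →
      (∀ a x, x ∈ I → x * a ∈ I) → I = ⊥ ∨ I = ⊤)
    (a b : A) (h : ∀ x, a * x * b = 0) : a = 0 ∨ b = 0 := by
  let I : Submodule k A :=
    { carrier := {y | ∀ x z, a * x * y * z = 0}
      add_mem' := fun {y y'} hy hy' x z => by
        rw [mul_add, add_mul, hy, hy', add_zero]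
      zero_mem' := fun x z => by simp
      smul_mem' := fun t y hy x z => by
        rw [mul_smul_comm, smul_mul_assoc, hy, smul_zero] }
  rcases hsimple I (fun s y hy x z => by rw [← mul_assoc, mul_assoc a]; exact hy _ _)
    (fun s y hy x z => by rw [← mul_assoc, mul_assoc _ s]; exact hy _ _) with hI | hI
  · right
    have : b ∈ I := fun x z => by rw [h, zero_mul]
    rw [hI] at this
    simpa using this
  · left
    have : (1 : A) ∈ I := hI ▸ trivial
    simpa using this 1 1

variable {A : Type*} [Ring A] [Algebra k A]

/-- The scalar extension of a linear functional. -/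
noncomputable def extendFunctional (K : Type*) [Field K] [Algebra k K] (φ : A →ₗ[k] k) :
    K ⊗[k] A →ₗ[K] K :=
  (TensorProduct.AlgebraTensorModule.rid k K K).toLinearMap ∘ₗ φ.baseChange K

theorem extendFunctional_tmul {K : Type*} [Field K] [Algebra k K] (φ : A →ₗ[k] k) (t : K)
    (x : A) : extendFunctional K φ (t ⊗ₜ x) = φ x • t := by
  simp [extendFunctional]

theorem baseChange_mul_eq_sum {ι : Type*} [Fintype ι] {α β : ι → A →ₗ[k] k} {c : ι → A}
    (hdec : ∀ x y, x * y = ∑ i, (α i x * β i y) • c i) (K : Type*) [Field K] [Algebra k K]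
    (x y : K ⊗[k] A) : x * y =
      ∑ i, (extendFunctional K (α i) x * extendFunctional K (β i) y) • ((1 : K) ⊗ₜ[k] c i) := by
  induction x using TensorProduct.induction_on with
  | zero => simp
  | add x x' hx hx' => simp only [add_mul, hx, hx', map_add, add_smul, Finset.sum_add_distrib]
  | tmul t x =>
    induction y using TensorProduct.induction_on with
    | zero => simp
    | add y y' hy hy' => simp only [mul_add, hy, hy', map_add, add_smul, Finset.sum_add_distrib]
    | tmul s y =>
      rw [Algebra.TensorProduct.tmul_mul_tmul, hdec, TensorProduct.tmul_sum]
      refine Finset.sum_congr rfl fun i _ => ?_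
      rw [extendFunctional_tmul, extendFunctional_tmul, TensorProduct.tmul_smul,
        TensorProduct.smul_tmul', TensorProduct.smul_tmul']
      congr 1
      simp only [smul_eq_mul, mul_one, smul_mul_smul_comm]

theorem exists_polynomial_coordinates {ι : Type*} [Fintype ι] (b : Module.Basis ι k A)
    {a : FractionRing k[X] ⊗[k] A} (ha : a ≠ 0) :
    ∃ (s : FractionRing k[X]) (p : ι → k[X]) (D : ℕ),
      s • a = ∑ i, algebraMap k[X] (FractionRing k[X]) (p i) ⊗ₜ[k] b i ∧
      (∀ i, (p i).natDegree ≤ D) ∧ ∑ i, (p i).coeff D • b i ≠ 0 := by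
  set B := b.baseChange (FractionRing k[X]) with hB
  obtain ⟨s, hs⟩ := IsLocalization.exist_integer_multiples_of_finite (nonZeroDivisors k[X])
    (fun i => B.repr a i)
  choose p hp using hs
  have hs0 : algebraMap k[X] (FractionRing k[X]) s ≠ 0 :=
    IsLocalization.to_map_ne_zero_of_mem_nonZeroDivisors _ le_rfl s.2
  have hp' : ∀ i, algebraMap k[X] (FractionRing k[X]) (p i) =
      algebraMap k[X] (FractionRing k[X]) s * B.repr a i := fun i => by
    rw [hp, Algebra.smul_def]
  obtain ⟨i₀, hi₀⟩ : ∃ i, B.repr a i ≠ 0 := by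
    by_contra! h
    exact ha (B.repr.map_eq_zero_iff.mp (Finsupp.ext h))
  have hpi₀ : p i₀ ≠ 0 := by
    intro h
    have := hp' i₀
    rw [h, map_zero] at this
    exact mul_ne_zero hs0 hi₀ this.symm
  classical
  obtain ⟨j, hj, hmax⟩ := Finset.exists_max_image (Finset.univ.filter fun i => p i ≠ 0)
    (fun i => (p i).natDegree) ⟨i₀, by simpa using hpi₀⟩
  refine ⟨algebraMap k[X] (FractionRing k[X]) s, p, (p j).natDegree, ?_, ?_, ?_⟩
  · conv_lhs => rw [← B.sum_repr a]
    rw [Finset.smul_sum]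
    refine Finset.sum_congr rfl fun i _ => ?_
    rw [smul_smul, ← hp', hB, Module.Basis.baseChange_apply, TensorProduct.smul_tmul', smul_eq_mul,
      mul_one]
  · intro i
    by_cases hi : p i = 0
    · simp [hi]
    · exact hmax i (by simpa using hi)
  · intro h
    have := (Fintype.linearIndependent_iff.mp b.linearIndependent) _ h j
    rw [Polynomial.coeff_natDegree, Polynomial.leadingCoeff_eq_zero] at this
    simp [this] at hj

theorem eq_zero_or_eq_zero_of_baseChange [FiniteDimensional k A]
    (hprime : ∀ a b : A, (∀ x, a * x * b = 0) → a = 0 ∨ b = 0)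
    (a b : FractionRing k[X] ⊗[k] A) (h : ∀ x, a * x * b = 0) : a = 0 ∨ b = 0 := by
  by_contra! hab
  set e := Module.finBasis k A
  obtain ⟨s, p, m, hsp, hpm, hp0⟩ := exists_polynomial_coordinates e hab.1
  obtain ⟨t, q, n, htq, hqn, hq0⟩ := exists_polynomial_coordinates e hab.2
  suffices hz : ∀ x, (∑ i, (p i).coeff m • e i) * x * (∑ i, (q i).coeff n • e i) = 0 by
    rcases hprime _ _ hz with h0 | h0
    exacts [hp0 h0, hq0 h0]
  intro x
  have h1 : (s • a) * ((1 : FractionRing k[X]) ⊗ₜ[k] x) * (t • b) = 0 := by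
    rw [smul_mul_assoc, smul_mul_assoc, mul_smul_comm, h, smul_zero, smul_zero]
  rw [hsp, htq, Finset.sum_mul, Finset.sum_mul_sum] at h1
  simp only [Algebra.TensorProduct.tmul_mul_tmul, mul_one, ← map_mul] at h1
  have hinj : Function.Injective (algebraMap k[X] (FractionRing k[X])) :=
    IsFractionRing.injective _ _
  apply e.ext_elem_iff.mpr
  intro l
  have h2 := congrArg (extendFunctional (FractionRing k[X]) (e.coord l)) h1
  simp only [map_sum, map_zero, extendFunctional_tmul] at h2
  simp only [← algebraMap_smul k[X] (_ : k) (_ : FractionRing k[X])] at h2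
  simp only [Algebra.smul_def, ← map_mul, ← map_sum] at h2
  rw [map_eq_zero_iff _ hinj] at h2
  have h3 := congrArg (fun r : k[X] => r.coeff (m + n)) h2
  simp only [Polynomial.finsetSum_coeff, Polynomial.algebraMap_eq, Polynomial.coeff_C_mul,
    Polynomial.coeff_mul_add_eq_of_natDegree_le (hpm _) (hqn _), Polynomial.coeff_zero] at h3
  rw [Finset.sum_mul, Finset.sum_mul_sum]
  simp only [smul_mul_assoc, mul_smul_comm, map_sum, map_smul, map_zero, Finsupp.coe_finsetSum,
    Finset.sum_apply, Finsupp.smul_apply, smul_eq_mul, Finsupp.coe_zero, Pi.zero_apply]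
  rw [← h3]
  refine Finset.sum_congr rfl fun i _ => Finset.sum_congr rfl fun j _ => ?_
  rw [Module.Basis.coord_apply]
  ring

end BaseChange

end MultiplicationRank

theorem stmt3 (k A : Type*) [Field k] [Ring A] [Algebra k A] [FiniteDimensional k A]
    (hsimple : ∀ I : Submodule k A, (∀ a x, x ∈ I → a * x ∈ I) →
      (∀ a x, x ∈ I → x * a ∈ I) → I = ⊥ ∨ I = ⊤)
    (r : ℕ) (α β : Fin r → (A →ₗ[k] k)) (c : Fin r → A)
    (hdecomp : ∀ x y : A, x * y = ∑ i, (α i x * β i y) • c i) :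
    2 * Module.finrank k A - 1 ≤ r := by
  cases subsingleton_or_nontrivial A with
  | inl h => simp [Module.finrank_zero_of_subsingleton]
  | inr h =>
    have hprime := eq_zero_or_eq_zero_of_baseChange (k := k) (eq_zero_or_eq_zero_of_simple hsimple)
    let K := FractionRing (Polynomial k)
    have hfin : Module.finrank K (TensorProduct k K A) = Module.finrank k A :=
      Module.finrank_baseChange
    have : Nontrivial (TensorProduct k K A) :=
      Module.nontrivial_of_finrank_pos (R := K) (by rw [hfin]; exact Module.finrank_pos)
    have : Infinite K := Infinite.of_injective (algebraMap (Polynomial k) K)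
      (IsFractionRing.injective _ _)
    have := two_mul_finrank_le_of_infinite (k := K) hprime (baseChange_mul_eq_sum hdecomp K)
    rw [hfin, Fintype.card_fin] at this
    omega
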